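/- The map γ: Nor_n → Q_{n−1} is a well-defined bijection, and for every Υ ∈ Nor_n and every internal node x of Υ: (1) x is not a Lyndon node if and only if (v^r(R(L(x))), v^r(R(x))) is an ascending adjacent pair of γ(Υ), and every ascending adjacent pair of γ(Υ) arises in this way; (2) the right child R(x) of x is an internal node if and only if (v^r(R(x)), v^r(R(R(x)))) is a terminally nested pair of γ(Υ), and every terminally nested pair of γ(Υ) arises in this way; (3) λ^{AA}(γ(Υ)) = λ^{Lyn}(Υ); (4) λ^{TN}(γ(Υ)) = λ^{Comb}(Υ). -/

import Mathlib

/-! Colored labeled binary trees.  Leaf labels are positive integers; colors are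
natural numbers (the paper's color set ℙ = {1,2,…} is identified with ℕ via j ↦ j-1,
i.e. color index `i : ℕ` represents the paper's color `i+1`). -/

inductive CTree : Type
  | leaf (label : ℕ) : CTree
  | node (color : ℕ) (l r : CTree) : CTree
deriving DecidableEq

namespace CTree

/-- leaf labels from left to right -/
def leavesList : CTree → List ℕ
  | leaf m => [m]
  | node _ l r => leavesList l ++ leavesList r

/-- the valency `v(x)`: smallest leaf label of the subtree -/
def minLeaf : CTree → ℕ
  | leaf m => m
  | node _ l r => min (minLeaf l) (minLeaf r)

/-- a tree is normalized if in every subtree the leftmost leaf carries the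
smallest leaf label of the subtree. -/
def Normalized : CTree → Prop
  | leaf _ => True
  | node _ l r => Normalized l ∧ Normalized r ∧ minLeaf l < minLeaf r

/-- number of internal nodes with color `j` -/
def colorCount : CTree → ℕ → ℕ
  | leaf _, _ => 0
  | node c l r, j => (if c = j then 1 else 0) + colorCount l j + colorCount r j

def isLeafB : CTree → Bool
  | leaf _ => true
  | node _ _ _ => false

def left : CTree → CTree
  | leaf m => leaf m
  | node _ l _ => l

def right : CTree → CTree
  | leaf m => leaf m
  | node _ _ r => r

def rootColor : CTree → ℕ
  | leaf _ => 0
  | node c _ _ => c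

/-- the root of `T` is a Lyndon node: either the left child is a leaf
or `v(R(L(x))) > v(R(x))`. (Leaves count as Lyndon.) -/
def RootLyndonB (T : CTree) : Bool :=
  isLeafB T || isLeafB (left T) || decide (minLeaf (right T) < minLeaf (right (left T)))

/-- colored Lyndon condition: every internal node that is not a Lyndon node
satisfies `color(L(x)) > color(x)` -/
def LynColored : CTree → Prop
  | leaf _ => True
  | node c l r => LynColored l ∧ LynColored r ∧
      (RootLyndonB (node c l r) = true ∨ c < rootColor l)

/-- colored comb condition: every internal node whose right child is internal
satisfies `color(x) > color(R(x))` -/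
def CombColored : CTree → Prop
  | leaf _ => True
  | node c l r => CombColored l ∧ CombColored r ∧ (isLeafB r = true ∨ rootColor r < c)

/-- all colors equal to `0`: an (essentially) uncolored tree. -/
def Mono : CTree → Prop
  | leaf _ => True
  | node c l r => c = 0 ∧ Mono l ∧ Mono r

/-- the tree has leaf label set `[n] = {1,…,n}` (each label once) -/
def OnSet (n : ℕ) (T : CTree) : Prop := T.leavesList.Perm ((List.range n).map (· + 1))

/-- `lynAux T = (b, m)`: `b` is the size of the block of `π^{Lyn}` containing the
root (`0` for a leaf) and `m` is the multiset of sizes of the other blocks. -/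
def lynAux : CTree → ℕ × Multiset ℕ
  | leaf _ => (0, 0)
  | node c l r =>
    let bl := (lynAux l).1
    let ml := (lynAux l).2
    let br := (lynAux r).1
    let mr := (lynAux r).2
    let closedR := mr + (if br = 0 then 0 else {br})
    if RootLyndonB (node c l r) then
      (1, ml + (if bl = 0 then 0 else {bl}) + closedR)
    else (1 + bl, ml + closedR)

/-- the Lyndon type `λ^{Lyn}`: multiset of block sizes of `π^{Lyn}` -/
def lynType (T : CTree) : Multiset ℕ :=
  (if (lynAux T).1 = 0 then (0 : Multiset ℕ) else {(lynAux T).1}) + (lynAux T).2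

def combAux : CTree → ℕ × Multiset ℕ
  | leaf _ => (0, 0)
  | node _ l r =>
    let bl := (combAux l).1
    let ml := (combAux l).2
    let br := (combAux r).1
    let mr := (combAux r).2
    (1 + br, ml + mr + (if bl = 0 then 0 else {bl}))

/-- the comb type `λ^{Comb}`: multiset of block sizes of `π^{Comb}` -/
def combType (T : CTree) : Multiset ℕ :=
  (if (combAux T).1 = 0 then (0 : Multiset ℕ) else {(combAux T).1}) + (combAux T).2

/-- subtrees (= nodes) of a tree -/
def subtreesC : CTree → List CTree
  | leaf m => [leaf m]
  | node c l r => node c l r :: (subtreesC l ++ subtreesC r)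

end CTree

/-- normalized uncolored labeled binary trees on `[n]`: the set `Nor_n`. -/
def NorSet (n : ℕ) : Set CTree :=
  {T | T.OnSet n ∧ T.Normalized ∧ T.Mono}

/-- `Lyn_μ` for a weak composition `μ` (indexed by ℕ; `μ i` is the number of
internal nodes of color `i`). -/
def LynSet (n : ℕ) (μ : ℕ →₀ ℕ) : Set CTree :=
  {T | T.OnSet n ∧ T.Normalized ∧ T.LynColored ∧ ∀ j, T.colorCount j = μ j}

/-- `Comb_μ` -/
def CombSet (n : ℕ) (μ : ℕ →₀ ℕ) : Set CTree :=
  {T | T.OnSet n ∧ T.Normalized ∧ T.CombColored ∧ ∀ j, T.colorCount j = μ j}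

/-- `Lyn_μ` for `μ ∈ wcomp` with support in `[k]`, given as `f : Fin k → ℕ`. -/
def LynSetF (n k : ℕ) (f : Fin k → ℕ) : Set CTree :=
  {T | T.OnSet n ∧ T.Normalized ∧ T.LynColored ∧
    ∀ j : ℕ, T.colorCount j = if h : j < k then f ⟨j, h⟩ else 0}

def CombSetF (n k : ℕ) (f : Fin k → ℕ) : Set CTree :=
  {T | T.OnSet n ∧ T.Normalized ∧ T.CombColored ∧
    ∀ j : ℕ, T.colorCount j = if h : j < k then f ⟨j, h⟩ else 0}

/-! Stirling permutations, as lists of natural numbers. -/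

/-- `w` is a Stirling permutation on the finite set `A` of positive integers:
every letter of `A` occurs exactly twice, no other letter occurs, and every
letter lying strictly between the two occurrences of a letter `a` is larger
than `a`. -/
def IsStirling (A : Finset ℕ) (w : List ℕ) : Prop :=
  (∀ a, w.count a = if a ∈ A then 2 else 0) ∧
  (∀ a b : ℕ, ∀ i l j : ℕ, i < l → l < j → w[i]? = some a → w[j]? = some a →
      w[l]? = some b → a < b)

/-- the set `Q_A` of Stirling permutations on `A` -/
def QSetA (A : Finset ℕ) : Set (List ℕ) := {w | IsStirling A w}

/-- the set `Q_m` of Stirling permutations on `[m]` -/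
def QSet (m : ℕ) : Set (List ℕ) := QSetA (Finset.Icc 1 m)

/-- `(a,b)` is an ascending adjacent pair of `w`: `a < b` and the second
occurrence of `a` immediately precedes the first occurrence of `b`. -/
def AApair (w : List ℕ) (a b : ℕ) : Prop :=
  a < b ∧ ∃ i, w[i]? = some a ∧ w[i+1]? = some b ∧
    (w.take (i+1)).count a = 2 ∧ (w.take (i+1)).count b = 0

/-- `(a,b)` is a terminally nested pair of `w`: `a < b` and the second
occurrence of `a` immediately follows the second occurrence of `b`. -/
def TNpair (w : List ℕ) (a b : ℕ) : Prop :=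
  a < b ∧ ∃ i, w[i]? = some b ∧ w[i+1]? = some a ∧
    (w.take (i+1)).count b = 2 ∧ (w.take (i+2)).count a = 2

-- Given a relation `R` on letters which is a partial matching (as `AApair w`
-- and `TNpair w` are), the multiset of sizes of the blocks of the partition of `A`
-- generated by `R`, i.e. the multiset of lengths of the maximal `R`-chains.
-- This gives the types `λ^{AA}` and `λ^{TN}` of a Stirling permutation.
open Classical in
noncomputable def chainType (A : Finset ℕ) (R : ℕ → ℕ → Prop) : Multiset ℕ :=
  ((A.image fun a => A.filter fun b => Relation.EqvGen R a b).val.map Finset.card)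

/-- splits off the first block `a τ a` of a Stirling permutation. -/
def blockSplit (w : List ℕ) : List ℕ × List ℕ :=
  match w with
  | [] => ([], [])
  | a :: rest =>
    let i := rest.findIdx (· = a)
    (a :: rest.take (i+1), rest.drop (i+1))

/-- block factorization of a Stirling permutation (with fuel). -/
def toBlocksAux : ℕ → List ℕ → List (List ℕ)
  | 0, _ => []
  | _+1, [] => []
  | f+1, w => (blockSplit w).1 :: toBlocksAux f (blockSplit w).2

def toBlocks (w : List ℕ) : List (List ℕ) := toBlocksAux w.length w

/-- splits a list of blocks at the first descent of the leading letters: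
this gives the ascending adjacent factorization `θ = θ¹θ²`. -/
def splitAtDescent : List (List ℕ) → Option (List (List ℕ) × List (List ℕ))
  | [] => none
  | [_] => none
  | b :: b' :: rest =>
    if b'.headD 0 < b.headD 0 then some ([b], b' :: rest)
    else (splitAtDescent (b' :: rest)).map fun p => (b :: p.1, p.2)

/-- the bijection `ξ : Q_A → Q_A` (with fuel).  On an irreducible AA-word
`a₁τ₁a₁ a₂τ₂a₂ ⋯ a_kτ_ka_k` it returns
`a₁ξ(τ₁) a₂ξ(τ₂) ⋯ a_{k-1}ξ(τ_{k-1}) a_k a_k a_{k-1} ⋯ a₂ a₁ ξ(τ_k)`, and it is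
multiplicative on the complete ascending adjacent factorization. -/
def xiAux : ℕ → List ℕ → List ℕ
  | 0, w => w
  | f+1, w =>
    let bs := toBlocks w
    match splitAtDescent bs with
    | some p => xiAux f p.1.flatten ++ xiAux f p.2.flatten
    | none =>
      match bs with
      | [] => []
      | _ =>
        let heads := bs.map fun b => b.headD 0
        let inners := bs.map fun b => (b.drop 1).dropLast
        (List.zipWith (fun a τ => a :: xiAux f τ) heads.dropLast inners.dropLast).flatten
          ++ (heads.getLastD 0 :: heads.reverse) ++ xiAux f (inners.getLastD [])

def xiMap (w : List ℕ) : List ℕ := xiAux (w.length + 1) w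

/-- the subword of first occurrences of the letters of `w` (with fuel). -/
def initAux : ℕ → List ℕ → List ℕ
  | 0, _ => []
  | _+1, [] => []
  | f+1, a :: rest => a :: initAux f (rest.filter (· ≠ a))

/-- the initial permutation `init(θ)` -/
def initPerm (w : List ℕ) : List ℕ := initAux w.length w

namespace CTree

/-- the map `γ̃ : Nor_A → Q̂_A`.  For a leaf labeled `m` it gives `mm`; for a tree
with left subtree `l` and right subtree `r` it inserts `γ̃(r)` just before the
final (minimal) letter of `γ̃(l)`, which amounts to the recursive description
`γ̃(Υ) = m γ̃(Υ₁) ⋯ γ̃(Υ_j) m` along the left spine ending at the leaf `m`. -/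
def gammaT : CTree → List ℕ
  | leaf m => [m, m]
  | node _ l r => (gammaT l).dropLast ++ gammaT r ++ [minLeaf l]

end CTree

/-- the reduction map `red : Q̂_n → Q_{n-1}`: remove the first and last letter
(both equal to 1) and decrease every remaining letter by one. -/
def redList (w : List ℕ) : List ℕ := ((w.drop 1).dropLast).map (· - 1)

/-- the bijection `γ = red ∘ γ̃ : Nor_n → Q_{n-1}` -/
def gammaMap (T : CTree) : List ℕ := redList (CTree.gammaT T)


namespace CTree

/-- interior word of `gammaT` -/
def gw : CTree → List ℕ
  | leaf _ => []
  | node _ l r => gw l ++ (minLeaf r :: (gw r ++ [minLeaf r]))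

theorem gw_last (c l r) : (gw (node c l r)).getLast? = some (minLeaf r) := by
  rw [gw, ← List.cons_append, ← List.append_assoc, List.getLast?_concat]

theorem minLeaf_mem : ∀ T : CTree, minLeaf T ∈ leavesList T
  | leaf m => by simp [minLeaf, leavesList]
  | node _ l r => by
    have hl := minLeaf_mem l
    have hr := minLeaf_mem r
    simp only [minLeaf, leavesList, List.mem_append]
    rcases min_choice (minLeaf l) (minLeaf r) with h | h <;> rw [h] <;> simp [hl, hr]

theorem minLeaf_le : ∀ (T : CTree) (a : ℕ), a ∈ leavesList T → minLeaf T ≤ a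
  | leaf m, a => by simp [minLeaf, leavesList]; omega
  | node _ l r, a => by
    have hl := minLeaf_le l a
    have hr := minLeaf_le r a
    simp only [minLeaf, leavesList, List.mem_append]
    rintro (h | h)
    · have := hl h; omega
    · have := hr h; omega

theorem gammaT_eq : ∀ T : CTree, T.Normalized → gammaT T = minLeaf T :: (gw T ++ [minLeaf T])
  | leaf m => by simp [gammaT, gw, minLeaf]
  | node _ l r => by
    rintro ⟨hl, hr, h⟩
    have e : min (minLeaf l) (minLeaf r) = minLeaf l := by omega
    have e2 : (minLeaf l :: (gw l ++ [minLeaf l])).dropLast = minLeaf l :: gw l := by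
      rw [← List.cons_append, List.dropLast_concat]
    simp only [gammaT, gammaT_eq l hl, gammaT_eq r hr, gw, minLeaf, e, e2]
    simp

theorem gammaMap_eq (T : CTree) (h : T.Normalized) : gammaMap T = (gw T).map (· - 1) := by
  simp [gammaMap, redList, gammaT_eq T h]

/-- good trees -/
def Good (T : CTree) : Prop := T.Normalized ∧ T.leavesList.Nodup

theorem Good.l {c l r} (h : Good (node c l r)) : Good l :=
  ⟨h.1.1, (List.nodup_append.1 h.2).1⟩
theorem Good.r {c l r} (h : Good (node c l r)) : Good r :=
  ⟨h.1.2.1, (List.nodup_append.1 h.2).2.1⟩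
theorem Good.lt {c l r} (h : Good (node c l r)) : minLeaf l < minLeaf r := h.1.2.2
theorem Good.disj {c l r} (h : Good (node c l r)) (a : ℕ) (ha : a ∈ leavesList l)
    (hb : a ∈ leavesList r) : False :=
  (List.nodup_append.1 h.2).2.2 a ha a hb rfl

theorem mem_gw : ∀ T : CTree, Good T → ∀ a, a ∈ gw T ↔ a ∈ leavesList T ∧ a ≠ minLeaf T
  | leaf m => by simp [gw, leavesList, minLeaf]
  | node _ l r => by
    intro h a
    have e : min (minLeaf l) (minLeaf r) = minLeaf l := by have := h.lt; omega
    have h1 := mem_gw l h.l a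
    have h2 := mem_gw r h.r a
    have h3 := minLeaf_mem r
    have h4 := minLeaf_le r a
    have h5 := h.lt
    have h6 := h.disj a
    simp only [gw, leavesList, minLeaf, List.mem_append, List.mem_cons, e, h1, h2,
      List.not_mem_nil, or_false]
    constructor
    · rintro (h | h | h | h)
      · tauto
      · subst h; exact ⟨Or.inr h3, by omega⟩
      · exact ⟨Or.inr h.1, by have := h4 h.1; omega⟩
      · subst h; exact ⟨Or.inr h3, by omega⟩
    · tauto

theorem gw_lt {T : CTree} (h : Good T) {a : ℕ} (ha : a ∈ gw T) : minLeaf T < a := by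
  have := (mem_gw T h a).1 ha
  have := minLeaf_le T a this.1
  omega

/-- separation facts for `u ++ x :: (v ++ [x])`. -/
structure Sep (u : List ℕ) (x : ℕ) (v : List ℕ) : Prop where
  xu : x ∉ u
  xv : x ∉ v
  uv : ∀ a ∈ u, a ∉ v
  cu : ∀ a ∈ u, u.count a = 2
  cv : ∀ a ∈ v, v.count a = 2

theorem Sep.count {u x v} (h : Sep u x v) (a : ℕ) (ha : a ∈ u ++ x :: (v ++ [x])) :
    (u ++ x :: (v ++ [x])).count a = 2 := by
  simp only [List.mem_append, List.mem_cons, List.not_mem_nil, or_false] at ha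
  have H : a ∈ u ∨ a = x ∨ a ∈ v := by tauto
  rcases H with H | H | H
  · have h1 : a ≠ x := by rintro rfl; exact h.xu H
    have h2 := List.count_eq_zero_of_not_mem (h.uv a H)
    simp [List.count_cons, h.cu a H, h2, h1.symm]
  · subst H
    simp [List.count_eq_zero_of_not_mem h.xu, List.count_eq_zero_of_not_mem h.xv]
  · have h1 : a ≠ x := by rintro rfl; exact h.xv H
    have h2 := List.count_eq_zero_of_not_mem (fun q => h.uv a q H)
    simp [List.count_cons, h.cv a H, h2, h1.symm]

theorem sep_of {c l r} (h : Good (node c l r))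
    (cu : ∀ a ∈ gw l, (gw l).count a = 2) (cv : ∀ a ∈ gw r, (gw r).count a = 2) :
    Sep (gw l) (minLeaf r) (gw r) where
  xu hx := h.disj _ ((mem_gw l h.l _).1 hx).1 (minLeaf_mem r)
  xv hx := ((mem_gw r h.r _).1 hx).2 rfl
  uv a ha hb := h.disj _ ((mem_gw l h.l _).1 ha).1 ((mem_gw r h.r _).1 hb).1
  cu := cu
  cv := cv

theorem count_gw : ∀ T : CTree, Good T → ∀ a ∈ gw T, (gw T).count a = 2
  | leaf m => by simp [gw]
  | node _ l r => fun h => (sep_of h (count_gw l h.l) (count_gw r h.r)).count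

theorem sep {c l r} (h : Good (node c l r)) : Sep (gw l) (minLeaf r) (gw r) :=
  sep_of h (count_gw l h.l) (count_gw r h.r)

theorem subtree_good : ∀ T : CTree, Good T → ∀ t ∈ subtreesC T, Good t
  | leaf m => by intro h t ht; simp [subtreesC] at ht; subst ht; exact h
  | node _ l r => by
    intro h t ht
    simp only [subtreesC, List.mem_cons, List.mem_append] at ht
    rcases ht with rfl | ht | ht
    · exact h
    · exact subtree_good l h.l t ht
    · exact subtree_good r h.r t ht

end CTree
open CTree

theorem take_of_get {w : List ℕ} {i a : ℕ} (h : w[i]? = some a) :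
    w.take (i+1) = w.take i ++ [a] ∧ w.drop i = a :: w.drop (i+1) := by
  obtain ⟨hi, rfl⟩ := List.getElem?_eq_some_iff.1 h
  exact ⟨by simp, by simp⟩

theorem AApair_iff (w : List ℕ) (a b : ℕ) : AApair w a b ↔
    a < b ∧ ∃ p s, w = p ++ a :: b :: s ∧ p.count a = 1 ∧ p.count b = 0 := by
  unfold AApair
  refine and_congr_right fun hab => ⟨?_, ?_⟩
  · rintro ⟨i, h1, h2, h3, h4⟩
    obtain ⟨t1, d1⟩ := take_of_get h1
    obtain ⟨t2, d2⟩ := take_of_get h2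
    refine ⟨w.take i, w.drop (i+1+1), ?_, ?_, ?_⟩
    · rw [← d2, ← d1, List.take_append_drop]
    · rw [t1] at h3; simpa using h3
    · rw [t1] at h4
      rw [List.count_append] at h4; omega
  · rintro ⟨p, s, rfl, h1, h2⟩
    refine ⟨p.length, by simp, by simp, ?_, ?_⟩
    · simp [List.take_append, List.take_of_length_le, h1]
    · simp [List.take_append, List.take_of_length_le, h2, List.count_cons, hab.ne]

theorem TNpair_iff (w : List ℕ) (a b : ℕ) : TNpair w a b ↔
    a < b ∧ ∃ p s, w = p ++ b :: a :: s ∧ p.count b = 1 ∧ p.count a = 1 := by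
  unfold TNpair
  refine and_congr_right fun hab => ⟨?_, ?_⟩
  · rintro ⟨i, h1, h2, h3, h4⟩
    obtain ⟨t1, d1⟩ := take_of_get h1
    obtain ⟨t2, d2⟩ := take_of_get h2
    refine ⟨w.take i, w.drop (i+1+1), ?_, ?_, ?_⟩
    · rw [← d2, ← d1, List.take_append_drop]
    · rw [t1] at h3; simpa using h3
    · rw [t2, t1] at h4
      simpa [List.count_cons, hab.ne'] using h4
  · rintro ⟨p, s, rfl, h1, h2⟩
    refine ⟨p.length, by simp, by simp, ?_, ?_⟩
    · simp [List.take_append, List.take_of_length_le, h1]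
    · simp [List.take_append, List.take_of_length_le, h2, List.count_cons, hab.ne']

/-- positions of an adjacent pair in `u ++ x :: (v ++ [x])`. -/
theorem adj_cases {u v : List ℕ} {x y z : ℕ} {p s : List ℕ}
    (h : u ++ x :: (v ++ [x]) = p ++ y :: z :: s) :
    (∃ t, u = p ++ y :: z :: t) ∨ (u = p ++ [y] ∧ z = x) ∨
    (p = u ∧ y = x) ∨ (∃ t p', p = u ++ x :: p' ∧ v = p' ++ y :: z :: t) ∨
    (∃ p', p = u ++ x :: p' ∧ v = p' ++ [y] ∧ z = x) := by
  rcases List.append_eq_append_iff.1 h with ⟨as, h1, h2⟩ | ⟨bs, h1, h2⟩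
  · cases as with
    | nil =>
      simp at h1 h2
      right; right; left; exact ⟨h1, h2.1.symm⟩
    | cons a as =>
      simp only [List.cons_append, List.cons.injEq] at h2
      obtain ⟨rfl, h2⟩ := h2
      right; right; right
      rcases List.append_eq_append_iff.1 h2 with ⟨cs, h3, h4⟩ | ⟨cs, h3, h4⟩
      · have := congrArg List.length h4
        simp at this
        omega
      · rcases cs with _ | ⟨c, _ | ⟨d, cs⟩⟩
        · simp at h4
        · simp at h4
          right
          exact ⟨as, h1, by rw [h3, h4.1], h4.2.1⟩
        · simp at h4
          left
          exact ⟨cs, as, h1, by rw [h3, h4.1, h4.2.1]⟩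
  · rcases bs with _ | ⟨c, _ | ⟨d, bs⟩⟩
    · simp at h1 h2
      right; right; left; exact ⟨h1.symm, h2.1⟩
    · simp at h2
      right; left; exact ⟨by rw [h1, h2.1], h2.2.1⟩
    · simp at h2
      left; exact ⟨bs, by rw [h1, h2.1, h2.2.1]⟩

theorem AApair_step {u v : List ℕ} {x : ℕ} (h : Sep u x v) (a b : ℕ) :
    AApair (u ++ x :: (v ++ [x])) a b ↔
      AApair u a b ∨ AApair v a b ∨ (a < b ∧ b = x ∧ u.getLast? = some a) := by
  simp only [AApair_iff]
  constructor
  · rintro ⟨hab, p, s, hw, ha, hb⟩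
    rcases adj_cases hw with ⟨t, hu⟩ | ⟨hu, hx⟩ | ⟨hu, hx⟩ | ⟨t, p', hp, hv⟩ | ⟨p', hp, hv, hx⟩
    · exact Or.inl ⟨hab, p, t, hu, ha, hb⟩
    · exact Or.inr (Or.inr ⟨hab, hx, by rw [hu]; simp⟩)
    · subst hu hx
      rw [List.count_eq_zero_of_not_mem h.xu] at ha; omega
    · refine Or.inr (Or.inl ⟨hab, p', t, hv, ?_, ?_⟩)
      · have h1 : a ∈ v := by rw [hv]; simp
        have h2 : a ∉ u := fun q => h.uv a q h1
        have h3 : x ≠ a := by rintro rfl; exact h.xv h1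
        subst hp
        simpa [List.count_cons, List.count_eq_zero_of_not_mem h2, h3] using ha
      · subst hp
        simp only [List.count_append, List.count_cons] at hb
        omega
    · subst hp hx
      simp at hb
  · rintro (⟨hab, p, s, rfl, ha, hb⟩ | ⟨hab, p, s, rfl, ha, hb⟩ | ⟨hab, rfl, hl⟩)
    · exact ⟨hab, p, s ++ x :: (v ++ [x]), by simp, ha, hb⟩
    · refine ⟨hab, u ++ x :: p, s ++ [x], by simp, ?_, ?_⟩
      · have h2 : a ∉ u := fun q => h.uv a q (by simp)
        have h3 : x ≠ a := by rintro rfl; exact h.xv (by simp)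
        simpa [List.count_cons, List.count_eq_zero_of_not_mem h2, h3] using ha
      · have h2 : b ∉ u := fun q => h.uv b q (by simp)
        have h3 : x ≠ b := by rintro rfl; exact h.xv (by simp)
        simp [List.count_cons, List.count_eq_zero_of_not_mem h2, h3, hb]
    · obtain ⟨p, rfl⟩ := List.getLast?_eq_some_iff.1 hl
      refine ⟨hab, p, v ++ [b], by simp, ?_, ?_⟩
      · have := h.cu a (by simp)
        simpa using this
      · exact List.count_eq_zero_of_not_mem fun q => h.xu (by simp [q])

theorem TNpair_step {u v : List ℕ} {x : ℕ} (h : Sep u x v) (a b : ℕ) :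
    TNpair (u ++ x :: (v ++ [x])) a b ↔
      TNpair u a b ∨ TNpair v a b ∨ (a < b ∧ a = x ∧ v.getLast? = some b) := by
  simp only [TNpair_iff]
  constructor
  · rintro ⟨hab, p, s, hw, hb, ha⟩
    rcases adj_cases hw with ⟨t, hu⟩ | ⟨hu, hx⟩ | ⟨hu, hx⟩ | ⟨t, p', hp, hv⟩ | ⟨p', hp, hv, hx⟩
    · exact Or.inl ⟨hab, p, t, hu, hb, ha⟩
    · subst hx
      have : a ∉ p := fun q => h.xu (by rw [hu]; simp [q])
      rw [List.count_eq_zero_of_not_mem this] at ha; omega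
    · subst hu hx
      rw [List.count_eq_zero_of_not_mem h.xu] at hb; omega
    · refine Or.inr (Or.inl ⟨hab, p', t, hv, ?_, ?_⟩)
      · have h1 : b ∈ v := by rw [hv]; simp
        have h2 : b ∉ u := fun q => h.uv b q h1
        have h3 : x ≠ b := by rintro rfl; exact h.xv h1
        subst hp
        simpa [List.count_cons, List.count_eq_zero_of_not_mem h2, h3] using hb
      · have h1 : a ∈ v := by rw [hv]; simp
        have h2 : a ∉ u := fun q => h.uv a q h1
        have h3 : x ≠ a := by rintro rfl; exact h.xv h1
        subst hp
        simpa [List.count_cons, List.count_eq_zero_of_not_mem h2, h3] using ha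
    · exact Or.inr (Or.inr ⟨hab, hx, by rw [hv]; simp⟩)
  · rintro (⟨hab, p, s, rfl, hb, ha⟩ | ⟨hab, p, s, rfl, hb, ha⟩ | ⟨hab, rfl, hl⟩)
    · exact ⟨hab, p, s ++ x :: (v ++ [x]), by simp, hb, ha⟩
    · refine ⟨hab, u ++ x :: p, s ++ [x], by simp, ?_, ?_⟩
      · have h2 : b ∉ u := fun q => h.uv b q (by simp)
        have h3 : x ≠ b := by rintro rfl; exact h.xv (by simp)
        simpa [List.count_cons, List.count_eq_zero_of_not_mem h2, h3] using hb
      · have h2 : a ∉ u := fun q => h.uv a q (by simp)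
        have h3 : x ≠ a := by rintro rfl; exact h.xv (by simp)
        simpa [List.count_cons, List.count_eq_zero_of_not_mem h2, h3] using ha
    · obtain ⟨p, rfl⟩ := List.getLast?_eq_some_iff.1 hl
      refine ⟨hab, u ++ a :: p, [], by simp, ?_, ?_⟩
      · have h1 := h.cv b (by simp)
        have h2 : b ∉ u := fun q => h.uv b q (by simp)
        simp [List.count_cons, List.count_eq_zero_of_not_mem h2, hab.ne] at h1 ⊢
        exact h1
      · have h2 : a ∉ p := fun q => h.xv (by simp [q])
        simp [List.count_eq_zero_of_not_mem h2, List.count_eq_zero_of_not_mem h.xu]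

theorem AApair_mem {w : List ℕ} {a b : ℕ} (h : AApair w a b) : a ∈ w ∧ b ∈ w := by
  obtain ⟨_, p, s, rfl, _⟩ := (AApair_iff w a b).1 h
  simp

theorem TNpair_mem {w : List ℕ} {a b : ℕ} (h : TNpair w a b) : a ∈ w ∧ b ∈ w := by
  obtain ⟨_, p, s, rfl, _⟩ := (TNpair_iff w a b).1 h
  simp

theorem map_pred_succ {w : List ℕ} (h : ∀ a ∈ w, 1 ≤ a) : (w.map (· - 1)).map (· + 1) = w := by
  rw [List.map_map]
  conv_rhs => rw [← List.map_id w]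
  apply List.map_congr_left
  intro a ha
  have := h a ha
  simp; omega

theorem getElem?_map_succ (w : List ℕ) (i a : ℕ) :
    (w.map (· + 1))[i]? = some (a + 1) ↔ w[i]? = some a := by
  simp

theorem count_map_succ (w : List ℕ) (a : ℕ) :
    (w.map (· + 1)).count (a + 1) = w.count a :=
  List.count_map_of_injective w (· + 1) (add_left_injective 1) a

theorem AApair_succ (w : List ℕ) (a b : ℕ) :
    AApair (w.map (· + 1)) (a + 1) (b + 1) ↔ AApair w a b := by
  unfold AApair
  simp only [getElem?_map_succ, ← List.map_take, count_map_succ]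
  simp

theorem TNpair_succ (w : List ℕ) (a b : ℕ) :
    TNpair (w.map (· + 1)) (a + 1) (b + 1) ↔ TNpair w a b := by
  unfold TNpair
  simp only [getElem?_map_succ, ← List.map_take, count_map_succ]
  simp

theorem AApair_pred {w : List ℕ} (h : ∀ a ∈ w, 1 ≤ a) (a b : ℕ) :
    AApair (w.map (· - 1)) a b ↔ AApair w (a + 1) (b + 1) := by
  rw [← AApair_succ, map_pred_succ h]

theorem TNpair_pred {w : List ℕ} (h : ∀ a ∈ w, 1 ≤ a) (a b : ℕ) :
    TNpair (w.map (· - 1)) a b ↔ TNpair w (a + 1) (b + 1) := by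
  rw [← TNpair_succ, map_pred_succ h]

/-! pairs and nodes -/

theorem AA_of_node : ∀ T : CTree, Good T → ∀ c cl ll lr r,
    node c (node cl ll lr) r ∈ subtreesC T → minLeaf lr ≤ minLeaf r →
    AApair (gw T) (minLeaf lr) (minLeaf r)
  | leaf m => by intro h c cl ll lr r hm; simp [subtreesC] at hm
  | node c0 l0 r0 => by
    intro h c cl ll lr r hm hle
    simp only [gw]
    rw [AApair_step (sep h)]
    simp only [subtreesC, List.mem_cons, List.mem_append] at hm
    rcases hm with hm | hm | hm
    · injection hm with h1 h2 h3
      subst h1 h2 h3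
      right; right
      refine ⟨lt_of_le_of_ne hle ?_, rfl, by simp [gw_last]⟩
      intro e
      exact h.disj (minLeaf r) (by simp [leavesList, ← e, minLeaf_mem]) (minLeaf_mem _)
    · exact Or.inl (AA_of_node l0 h.l _ _ _ _ _ hm hle)
    · exact Or.inr (Or.inl (AA_of_node r0 h.r _ _ _ _ _ hm hle))

theorem node_of_AA : ∀ T : CTree, Good T → ∀ a b, AApair (gw T) a b →
    ∃ c cl ll lr r, node c (node cl ll lr) r ∈ subtreesC T ∧
      minLeaf lr ≤ minLeaf r ∧ a = minLeaf lr ∧ b = minLeaf r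
  | leaf m => by intro h a b hab; have := (AApair_mem hab).1; simp [gw] at this
  | node c0 l0 r0 => by
    intro h a b hab
    simp only [gw] at hab
    rw [AApair_step (sep h)] at hab
    rcases hab with hab | hab | ⟨h1, h2, h3⟩
    · obtain ⟨c, cl, ll, lr, r, hm, h'⟩ := node_of_AA l0 h.l a b hab
      exact ⟨c, cl, ll, lr, r, by simp [subtreesC, hm], h'⟩
    · obtain ⟨c, cl, ll, lr, r, hm, h'⟩ := node_of_AA r0 h.r a b hab
      exact ⟨c, cl, ll, lr, r, by simp [subtreesC, hm], h'⟩
    · cases l0 with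
      | leaf m => simp [gw] at h3
      | node cl ll lr =>
        simp [gw_last] at h3
        exact ⟨c0, cl, ll, lr, r0, by simp [subtreesC], by omega, h3.symm, h2⟩

theorem TN_of_node : ∀ T : CTree, Good T → ∀ c cr l rl rr,
    node c l (node cr rl rr) ∈ subtreesC T →
    TNpair (gw T) (min (minLeaf rl) (minLeaf rr)) (minLeaf rr)
  | leaf m => by intro h c cl ll lr r hm; simp [subtreesC] at hm
  | node c0 l0 r0 => by
    intro h c cr l rl rr hm
    simp only [gw]
    rw [TNpair_step (sep h)]
    simp only [subtreesC, List.mem_cons, List.mem_append] at hm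
    rcases hm with hm | hm | hm
    · injection hm with h1 h2 h3
      subst h1 h2 h3
      right; right
      refine ⟨?_, rfl, by simp [gw_last]⟩
      have := h.r.lt
      omega
    · exact Or.inl (TN_of_node l0 h.l _ _ _ _ _ hm)
    · exact Or.inr (Or.inl (TN_of_node r0 h.r _ _ _ _ _ hm))

theorem node_of_TN : ∀ T : CTree, Good T → ∀ a b, TNpair (gw T) a b →
    ∃ c cr l rl rr, node c l (node cr rl rr) ∈ subtreesC T ∧
      a = min (minLeaf rl) (minLeaf rr) ∧ b = minLeaf rr
  | leaf m => by intro h a b hab; have := (TNpair_mem hab).1; simp [gw] at this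
  | node c0 l0 r0 => by
    intro h a b hab
    simp only [gw] at hab
    rw [TNpair_step (sep h)] at hab
    rcases hab with hab | hab | ⟨h1, h2, h3⟩
    · obtain ⟨c, cl, ll, lr, r, hm, h'⟩ := node_of_TN l0 h.l a b hab
      exact ⟨c, cl, ll, lr, r, by simp [subtreesC, hm], h'⟩
    · obtain ⟨c, cl, ll, lr, r, hm, h'⟩ := node_of_TN r0 h.r a b hab
      exact ⟨c, cl, ll, lr, r, by simp [subtreesC, hm], h'⟩
    · cases r0 with
      | leaf m => simp [gw] at h3
      | node cl ll lr =>
        simp [gw_last] at h3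
        exact ⟨c0, cl, l0, ll, lr, by simp [subtreesC], h2, h3.symm⟩

/-! block partitions -/

structure IsPart (A : Finset ℕ) (R : ℕ → ℕ → Prop) (P : List (Finset ℕ)) : Prop where
  disj : P.Pairwise Disjoint
  cover : ∀ a, a ∈ A ↔ ∃ p ∈ P, a ∈ p
  conn : ∀ p ∈ P, ∀ a ∈ p, ∀ b ∈ p, Relation.EqvGen R a b
  closed : ∀ a b, R a b → ∃ p ∈ P, a ∈ p ∧ b ∈ p

theorem IsPart.uniq {A R P} (h : IsPart A R P) {p q : Finset ℕ} (hp : p ∈ P) (hq : q ∈ P) {a : ℕ}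
    (ha : a ∈ p) (hb : a ∈ q) : p = q := by
  by_contra hne
  have := h.disj.forall hp hq hne
  exact Finset.disjoint_left.1 this ha hb

theorem IsPart.eqv {A R P} (h : IsPart A R P) {a b : ℕ} (hab : Relation.EqvGen R a b) :
    ∀ p ∈ P, (a ∈ p ↔ b ∈ p) := by
  induction hab with
  | rel x y hxy =>
    intro p hp
    obtain ⟨q, hq, h1, h2⟩ := h.closed x y hxy
    constructor
    · intro hx; rw [h.uniq hp hq hx h1]; exact h2
    · intro hx; rw [h.uniq hp hq hx h2]; exact h1
  | refl x => intro p _; rfl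
  | symm x y _ ih => intro p hp; exact (ih p hp).symm
  | trans x y z _ _ ih1 ih2 => intro p hp; exact (ih1 p hp).trans (ih2 p hp)

theorem IsPart.chainType_eq {A R P} (h : IsPart A R P) :
    chainType A R = ((P.map Finset.card : List ℕ) : Multiset ℕ).filter (· ≠ 0) := by
  classical
  unfold chainType
  have hcls : ∀ p ∈ P, ∀ a ∈ p, (A.filter fun b => Relation.EqvGen R a b) = p := by
    intro p hp a ha
    ext b
    simp only [Finset.mem_filter]
    constructor
    · rintro ⟨_, hb⟩; exact (h.eqv hb p hp).1 ha
    · intro hb; exact ⟨(h.cover b).2 ⟨p, hp, hb⟩, h.conn p hp a ha b hb⟩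
  have hnd : (P.filter (fun p => p.card ≠ 0)).Nodup := by
    have h1 := h.disj.filter (fun p => decide (p.card ≠ 0))
    apply List.Pairwise.imp_of_mem _ h1
    intro p q hp hq hd e
    subst e
    rw [List.mem_filter] at hp
    simp at hd hp
    exact hp.2 hd
  have himg : (A.image fun a => A.filter fun b => Relation.EqvGen R a b) =
      (P.filter (fun p => p.card ≠ 0)).toFinset := by
    ext q
    simp only [Finset.mem_image, List.mem_toFinset, List.mem_filter]
    constructor
    · rintro ⟨a, ha, rfl⟩
      obtain ⟨p, hp, hap⟩ := (h.cover a).1 ha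
      rw [hcls p hp a hap]
      refine ⟨hp, ?_⟩
      have : p.card ≠ 0 := Finset.card_ne_zero_of_mem hap
      simpa using this
    · rintro ⟨hq, hc⟩
      have hc : q.card ≠ 0 := by simpa using hc
      obtain ⟨a, ha⟩ := Finset.card_ne_zero.1 hc
      exact ⟨a, (h.cover a).2 ⟨q, hq, ha⟩, hcls q hq a ha⟩
  have e1 : (A.image fun a => A.filter fun b => Relation.EqvGen R a b).val.map Finset.card =
      ((P.map Finset.card : List ℕ) : Multiset ℕ).filter (· ≠ 0) := by
    rw [himg, List.toFinset_val, hnd.dedup]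
    simp only [Multiset.map_coe, Multiset.filter_coe, List.filter_map]
    rfl
  convert e1

theorem IsPart.nil {A R P} (h : IsPart A R P) : IsPart A R (∅ :: P) where
  disj := by simp [h.disj]
  cover a := by rw [h.cover]; simp
  conn := by simpa using h.conn
  closed a b hab := by obtain ⟨p, hp, h'⟩ := h.closed a b hab; exact ⟨p, by simp [hp], h'⟩

theorem IsPart.join {A B RA RB q P Q} {x : ℕ} (hA : IsPart A RA (q :: P)) (hB : IsPart B RB Q)
    (xA : x ∉ A) (xB : x ∉ B) (hAB : ∀ a ∈ A, a ∉ B) {R L : ℕ → ℕ → Prop}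
    (hR : ∀ a b, R a b ↔ RA a b ∨ RB a b ∨ L a b)
    (hL : ∀ a b, L a b → (a = x ∧ b ∈ q) ∨ (b = x ∧ a ∈ q))
    (hq : ∀ y ∈ q, ∃ z ∈ q, L z x ∨ L x z) :
    IsPart (insert x (A ∪ B)) R (insert x q :: (P ++ Q)) := by
  have liftA : ∀ a b, Relation.EqvGen RA a b → Relation.EqvGen R a b := fun a b h =>
    Relation.EqvGen.mono (fun a b h => (hR a b).2 (Or.inl h)) _ _ h
  have liftB : ∀ a b, Relation.EqvGen RB a b → Relation.EqvGen R a b := fun a b h =>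
    Relation.EqvGen.mono (fun a b h => (hR a b).2 (Or.inr (Or.inl h))) _ _ h
  have subA : ∀ p ∈ q :: P, ∀ a ∈ p, a ∈ A := fun p hp a ha => (hA.cover a).2 ⟨p, hp, ha⟩
  have subB : ∀ p ∈ Q, ∀ a ∈ p, a ∈ B := fun p hp a ha => (hB.cover a).2 ⟨p, hp, ha⟩
  have hxq : ∀ y ∈ q, Relation.EqvGen R x y := by
    intro y hy
    obtain ⟨z, hz, hzx⟩ := hq y hy
    have h1 : Relation.EqvGen R z y := liftA _ _ (hA.conn q (by simp) z hz y hy)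
    refine Relation.EqvGen.trans _ _ _ ?_ h1
    rcases hzx with h | h
    · exact Relation.EqvGen.symm _ _ (Relation.EqvGen.rel _ _ ((hR _ _).2 (Or.inr (Or.inr h))))
    · exact Relation.EqvGen.rel _ _ ((hR _ _).2 (Or.inr (Or.inr h)))
  constructor
  · have hd := List.pairwise_cons.1 hA.disj
    rw [List.pairwise_cons]
    constructor
    · intro p hp
      rw [Finset.disjoint_insert_left]
      rw [List.mem_append] at hp
      rcases hp with hp | hp
      · exact ⟨fun hx => xA (subA p (by simp [hp]) x hx), hd.1 p hp⟩
      · refine ⟨fun hx => xB (subB p hp x hx), ?_⟩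
        rw [Finset.disjoint_left]
        intro a ha hb
        exact hAB a (subA q (by simp) a ha) (subB p hp a hb)
    · rw [List.pairwise_append]
      refine ⟨hd.2, hB.disj, ?_⟩
      intro p hp r hr
      rw [Finset.disjoint_left]
      intro a ha hb
      exact hAB a (subA p (by simp [hp]) a ha) (subB r hr a hb)
  · intro a
    rw [Finset.mem_insert, Finset.mem_union, hA.cover, hB.cover]
    simp only [List.mem_cons, List.mem_append, or_and_right, exists_or, exists_eq_left, Finset.mem_insert, or_assoc]
  · intro p hp a ha b hb
    simp only [List.mem_cons, List.mem_append] at hp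
    rcases hp with rfl | hp | hp
    · have hx : ∀ y ∈ insert x q, Relation.EqvGen R x y := by
        intro y hy
        rcases Finset.mem_insert.1 hy with rfl | hy
        · exact Relation.EqvGen.refl _
        · exact hxq y hy
      exact Relation.EqvGen.trans _ _ _ (Relation.EqvGen.symm _ _ (hx a ha)) (hx b hb)
    · exact liftA _ _ (hA.conn p (by simp [hp]) a ha b hb)
    · exact liftB _ _ (hB.conn p hp a ha b hb)
  · intro a b hab
    rcases (hR a b).1 hab with h | h | h
    · obtain ⟨p, hp, h1, h2⟩ := hA.closed a b h
      rcases List.mem_cons.1 hp with rfl | hp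
      · exact ⟨insert x p, by simp, by simp [h1], by simp [h2]⟩
      · exact ⟨p, by simp [hp], h1, h2⟩
    · obtain ⟨p, hp, h1, h2⟩ := hB.closed a b h
      exact ⟨p, by simp [hp], h1, h2⟩
    · refine ⟨insert x q, by simp, ?_⟩
      rcases hL a b h with ⟨rfl, h⟩ | ⟨rfl, h⟩ <;> simp [h]

theorem IsPart.pred {A R P} (h : IsPart A R P) (hA : ∀ a ∈ A, 1 ≤ a) {A' : Finset ℕ}
    {R' : ℕ → ℕ → Prop} (hA' : ∀ a, a ∈ A' ↔ a + 1 ∈ A) (hR : ∀ a b, R' a b ↔ R (a+1) (b+1)) :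
    chainType A' R' = chainType A R := by
  have sub : ∀ p ∈ P, ∀ a ∈ p, 1 ≤ a := fun p hp a ha => hA a ((h.cover a).2 ⟨p, hp, ha⟩)
  have hm : ∀ p ∈ P, ∀ a, a ∈ p.image (· - 1) ↔ a + 1 ∈ p := by
    intro p hp a
    rw [Finset.mem_image]
    constructor
    · rintro ⟨b, hb, rfl⟩
      have := sub p hp b hb
      rwa [Nat.sub_add_cancel this]
    · intro ha; exact ⟨a + 1, ha, by simp⟩
  have hE : ∀ x y, Relation.EqvGen R x y → Relation.EqvGen R' (x - 1) (y - 1) := by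
    intro x y hxy
    induction hxy with
    | rel x y hxy =>
      obtain ⟨p, hp, h1, h2⟩ := h.closed x y hxy
      apply Relation.EqvGen.rel
      rw [hR, Nat.sub_add_cancel (sub p hp x h1), Nat.sub_add_cancel (sub p hp y h2)]
      exact hxy
    | refl x => exact Relation.EqvGen.refl _
    | symm x y _ ih => exact Relation.EqvGen.symm _ _ ih
    | trans x y z _ _ ih1 ih2 => exact Relation.EqvGen.trans _ _ _ ih1 ih2
  have h' : IsPart A' R' (P.map (fun p => p.image (· - 1))) := by
    constructor
    · rw [List.pairwise_map]
      apply List.Pairwise.imp_of_mem _ h.disj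
      intro p q hp hq hd
      rw [Finset.disjoint_left] at hd ⊢
      intro a ha hb
      exact hd ((hm p hp a).1 ha) ((hm q hq a).1 hb)
    · intro a
      rw [hA', h.cover]
      simp only [List.mem_map, exists_exists_and_eq_and]
      exact exists_congr fun p => and_congr_right fun hp => (hm p hp a).symm
    · intro p' hp' a ha b hb
      obtain ⟨p, hp, rfl⟩ := List.mem_map.1 hp'
      have := hE _ _ (h.conn p hp _ ((hm p hp a).1 ha) _ ((hm p hp b).1 hb))
      simpa using this
    · intro a b hab
      obtain ⟨p, hp, h1, h2⟩ := h.closed _ _ ((hR a b).1 hab)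
      exact ⟨_, List.mem_map.2 ⟨p, hp, rfl⟩, (hm p hp a).2 h1, (hm p hp b).2 h2⟩
  rw [h.chainType_eq, h'.chainType_eq, List.map_map]
  congr 2
  apply List.map_congr_left
  intro p hp
  apply Finset.card_image_of_injOn
  intro a ha b hb hab
  have := sub p hp a ha
  have := sub p hp b hb
  simp at hab
  omega

theorem filt_single (b : ℕ) : (if b = 0 then (0 : Multiset ℕ) else {b}) =
    Multiset.filter (· ≠ 0) {b} := by
  rw [Multiset.filter_singleton]
  by_cases h : b = 0 <;> simp [h]

theorem rootLyndon_node (c cl ll lr r) : RootLyndonB (node c (node cl ll lr) r) = true ↔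
    minLeaf r < minLeaf lr := by
  simp only [RootLyndonB, isLeafB, left, right, Bool.false_or]
  exact decide_eq_true_iff

theorem lynAux_pos {c l r} (h : RootLyndonB (node c l r) = true) : lynAux (node c l r) =
    (1, ((lynAux l).2 + Multiset.filter (· ≠ 0) {(lynAux l).1}) +
      ((lynAux r).2 + Multiset.filter (· ≠ 0) {(lynAux r).1})) := by
  rw [← filt_single, ← filt_single]
  exact if_pos h

theorem lynAux_neg {c l r} (h : ¬ RootLyndonB (node c l r) = true) : lynAux (node c l r) =
    (1 + (lynAux l).1, (lynAux l).2 +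
      ((lynAux r).2 + Multiset.filter (· ≠ 0) {(lynAux r).1})) := by
  rw [← filt_single]
  exact if_neg h

theorem gw_toFinset_node (c l r) : (gw (node c l r)).toFinset =
    insert (minLeaf r) ((gw l).toFinset ∪ (gw r).toFinset) := by
  ext a; simp [gw]

theorem isPart_leaf {R : ℕ → ℕ → Prop} (hR : ∀ a b, ¬ R a b) : IsPart ∅ R [∅] where
  disj := by simp
  cover := by simp
  conn := by simp
  closed a b h := (hR a b h).elim

theorem lyn_part : ∀ T : CTree, Good T → ∃ q P,
    IsPart (gw T).toFinset (AApair (gw T)) (q :: P) ∧ q.card = (lynAux T).1 ∧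
    ((P.map Finset.card : List ℕ) : Multiset ℕ).filter (· ≠ 0) = (lynAux T).2 ∧
    ∀ y, (gw T).getLast? = some y → y ∈ q
  | leaf m => fun _ => ⟨∅, [], isPart_leaf (fun a b h => by
      have := (AApair_mem h).1; simp [gw] at this), by simp [lynAux], by simp [lynAux],
      by simp [gw]⟩
  | node c l r => by
    intro h
    obtain ⟨ql, Pl, hl, hl1, hl2, hl3⟩ := lyn_part l h.l
    obtain ⟨qr, Pr, hr, hr1, hr2, hr3⟩ := lyn_part r h.r
    have hs := sep h
    have xA : minLeaf r ∉ (gw l).toFinset := by simpa using hs.xu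
    have xB : minLeaf r ∉ (gw r).toFinset := by simpa using hs.xv
    have hAB : ∀ a ∈ (gw l).toFinset, a ∉ (gw r).toFinset := by simpa using hs.uv
    have hR : ∀ a b, AApair (gw (node c l r)) a b ↔ AApair (gw l) a b ∨ AApair (gw r) a b ∨
      (a < b ∧ b = minLeaf r ∧ (gw l).getLast? = some a) := AApair_step hs
    rw [gw_toFinset_node]
    by_cases hL : RootLyndonB (node c l r) = true
    · refine ⟨insert (minLeaf r) ∅, (ql :: Pl) ++ (qr :: Pr),
        hl.nil.join hr xA xB hAB (L := fun _ _ => False) ?_ (by simp) (by simp), ?_, ?_, ?_⟩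
      · intro a b
        rw [hR]
        have : ¬ (a < b ∧ b = minLeaf r ∧ (gw l).getLast? = some a) := by
          rintro ⟨h1, h2, h3⟩
          cases l with
          | leaf m => simp [gw] at h3
          | node cl ll lr =>
            simp [gw_last] at h3
            rw [rootLyndon_node] at hL
            omega
        tauto
      · simp [lynAux_pos hL]
      · rw [lynAux_pos hL, ← hl1, ← hr1, ← hl2, ← hr2]
        simp only [← Multiset.filter_add]
        congr 1
        simp only [List.map_append, List.map_cons, ← Multiset.coe_add, ← Multiset.cons_coe,
          ← Multiset.singleton_add]
        abel
      · simp [gw_last]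
    · cases l with
      | leaf m => simp [RootLyndonB, isLeafB, left] at hL
      | node cl ll lr =>
        have hlt : minLeaf lr < minLeaf r := by
          rw [rootLyndon_node, not_lt] at hL
          refine lt_of_le_of_ne hL ?_
          intro e
          exact h.disj (minLeaf r) (by simp [leavesList, ← e, minLeaf_mem]) (minLeaf_mem _)
        have hlast : (gw (node cl ll lr)).getLast? = some (minLeaf lr) := gw_last _ _ _
        refine ⟨insert (minLeaf r) ql, Pl ++ (qr :: Pr),
          hl.join hr xA xB hAB hR ?_ ?_, ?_, ?_, ?_⟩
        · rintro a b ⟨h1, h2, h3⟩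
          exact Or.inr ⟨h2, hl3 a h3⟩
        · intro _ _
          exact ⟨minLeaf lr, hl3 _ hlast, Or.inl ⟨hlt, rfl, hlast⟩⟩
        · rw [Finset.card_insert_of_notMem (fun hx => xA ((hl.cover _).2 ⟨ql, by simp, hx⟩)), hl1]
          rw [lynAux_neg hL]
          simp [add_comm]
        · rw [lynAux_neg hL, ← hl2, ← hr2, ← hr1]
          simp only [← Multiset.filter_add]
          congr 1
          simp only [List.map_append, List.map_cons, ← Multiset.coe_add, ← Multiset.cons_coe,
            ← Multiset.singleton_add]
          abel
        · intro y hy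
          simp [gw_last] at hy
          simp [hy]

theorem comb_part : ∀ T : CTree, Good T → ∃ q P,
    IsPart (gw T).toFinset (TNpair (gw T)) (q :: P) ∧ q.card = (combAux T).1 ∧
    ((P.map Finset.card : List ℕ) : Multiset ℕ).filter (· ≠ 0) = (combAux T).2 ∧
    (∀ y, (gw T).getLast? = some y → y ∈ q) ∧ ((gw T).getLast? = none → q = ∅)
  | leaf m => fun _ => ⟨∅, [], isPart_leaf (fun a b h => by
      have := (TNpair_mem h).1; simp [gw] at this), by simp [combAux], by simp [combAux],
      by simp [gw], by simp⟩
  | node c l r => by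
    intro h
    obtain ⟨ql, Pl, hl, hl1, hl2, hl3, hl4⟩ := comb_part l h.l
    obtain ⟨qr, Pr, hr, hr1, hr2, hr3, hr4⟩ := comb_part r h.r
    have hs := sep h
    have xA : minLeaf r ∉ (gw l).toFinset := by simpa using hs.xu
    have xB : minLeaf r ∉ (gw r).toFinset := by simpa using hs.xv
    have hAB : ∀ a ∈ (gw r).toFinset, a ∉ (gw l).toFinset := by
      intro a h1 h2; exact hs.uv a (by simpa using h2) (by simpa using h1)
    have hR : ∀ a b, TNpair (gw (node c l r)) a b ↔ TNpair (gw r) a b ∨ TNpair (gw l) a b ∨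
      (a < b ∧ a = minLeaf r ∧ (gw r).getLast? = some b) := by
      intro a b
      have := TNpair_step hs a b
      simp only [gw]
      tauto
    rw [gw_toFinset_node, Finset.union_comm]
    refine ⟨insert (minLeaf r) qr, Pr ++ (ql :: Pl),
      hr.join hl xB xA hAB hR ?_ ?_, ?_, ?_, ?_, ?_⟩
    · rintro a b ⟨h1, h2, h3⟩
      exact Or.inl ⟨h2, hr3 b h3⟩
    · intro y hy
      rcases hlast : (gw r).getLast? with _ | z
      · rw [hr4 hlast] at hy; simp at hy
      · refine ⟨z, hr3 z hlast, Or.inr ⟨?_, rfl, rfl⟩⟩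
        exact gw_lt h.r (List.mem_of_getLast? hlast)
    · rw [Finset.card_insert_of_notMem (fun hx => xB ((hr.cover _).2 ⟨qr, by simp, hx⟩)), hr1]
      simp [combAux, add_comm]
    · rw [combAux]
      simp only []
      rw [filt_single, ← hl2, ← hr2, ← hl1]
      simp only [← Multiset.filter_add]
      congr 1
      simp only [List.map_append, List.map_cons, ← Multiset.coe_add, ← Multiset.cons_coe,
        ← Multiset.singleton_add]
      abel
    · intro y hy
      simp [gw_last] at hy
      simp [hy]
    · simp [gw_last]

theorem type_aux {q : Finset ℕ} {P : List (Finset ℕ)} {b : ℕ} {m : Multiset ℕ}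
    (h1 : q.card = b) (h2 : ((P.map Finset.card : List ℕ) : Multiset ℕ).filter (· ≠ 0) = m) :
    (((q :: P).map Finset.card : List ℕ) : Multiset ℕ).filter (· ≠ 0) =
      (if b = 0 then (0 : Multiset ℕ) else {b}) + m := by
  rw [filt_single, ← h1, ← h2, ← Multiset.filter_add, Multiset.singleton_add]
  simp

/-! Stirling condition via sublists -/

def St (w : List ℕ) : Prop := ∀ a b, [a, b, a].Sublist w → a < b

theorem sub3_iff (w : List ℕ) (a b : ℕ) : [a, b, a].Sublist w ↔
    ∃ i l j : ℕ, i < l ∧ l < j ∧ w[i]? = some a ∧ w[j]? = some a ∧ w[l]? = some b := by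
  constructor
  · intro h
    obtain ⟨f, hf⟩ := List.sublist_iff_exists_orderEmbedding_getElem?_eq.1 h
    have h0 := hf 0
    have h1 := hf 1
    have h2 := hf 2
    simp at h0 h1 h2
    exact ⟨f 0, f 1, f 2, f.strictMono (by norm_num), f.strictMono (by norm_num),
      h0.symm, h2.symm, h1.symm⟩
  · rintro ⟨i, l, j, hil, hlj, ha, ha', hb⟩
    have e1 := (take_of_get ha).2
    have h1 : (w.drop i).Sublist w := List.drop_sublist _ _
    rw [e1] at h1
    refine List.Sublist.trans (List.Sublist.cons_cons a ?_) h1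
    have e2 := (take_of_get hb).2
    have h2 : (w.drop l).Sublist (w.drop (i+1)) := List.drop_sublist_drop_left _ hil
    rw [e2] at h2
    refine List.Sublist.trans (List.Sublist.cons_cons b ?_) h2
    have e3 := (take_of_get ha').2
    have h3 : (w.drop j).Sublist (w.drop (l+1)) := List.drop_sublist_drop_left _ hlj
    rw [e3] at h3
    refine List.Sublist.trans (List.Sublist.cons_cons a (List.nil_sublist _)) h3

theorem isStirling_iff (A : Finset ℕ) (w : List ℕ) : IsStirling A w ↔
    (∀ a, w.count a = if a ∈ A then 2 else 0) ∧ St w := by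
  unfold IsStirling St
  refine and_congr_right fun _ => ?_
  simp only [sub3_iff]
  constructor
  · rintro h a b ⟨i, l, j, h1, h2, h3, h4, h5⟩
    exact h a b i l j h1 h2 h3 h4 h5
  · intro h a b i l j h1 h2 h3 h4 h5
    exact h a b ⟨i, l, j, h1, h2, h3, h4, h5⟩

theorem St_map_succ (w : List ℕ) : St (w.map (· + 1)) ↔ St w := by
  unfold St
  constructor
  · intro h a b hs
    have := h (a+1) (b+1) (by simpa using hs.map (· + 1))
    omega
  · intro h a b hs
    have h1 : a ∈ w.map (· + 1) := hs.subset (by simp)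
    have h2 : b ∈ w.map (· + 1) := hs.subset (by simp)
    obtain ⟨a, -, rfl⟩ := List.mem_map.1 h1
    obtain ⟨b, -, rfl⟩ := List.mem_map.1 h2
    have h3 := hs.map (· - 1)
    simp [Function.comp_def] at h3
    have := h a b h3
    simpa using this

theorem St_step {u v : List ℕ} {x : ℕ} (h : Sep u x v) (hu : St u) (hv : St v)
    (hx : ∀ b ∈ v, x < b) : St (u ++ x :: (v ++ [x])) := by
  intro a b hs
  have ha : a ∈ u ++ x :: (v ++ [x]) := hs.subset (by simp)
  have H : a ∈ u ∨ a = x ∨ a ∈ v := by simp at ha; tauto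
  -- restrict the word to letters of the given part
  rcases H with H | H | H
  · obtain ⟨s1, s2, e, h1, h2⟩ := List.sublist_append_iff.1 hs
    have hna : a ∉ s2 := by
      intro q
      have := h2.subset q
      simp at this
      rcases this with rfl | this | rfl
      · exact h.xu H
      · exact h.uv a H this
      · exact h.xu H
    rcases List.eq_nil_or_concat s2 with rfl | ⟨s, z, rfl⟩
    · simp at e; subst e; exact hu a b h1
    · exfalso
      have e' := congrArg List.getLast? e
      simp at e'
      subst e'
      simp at hna
  · subst H
    obtain ⟨s1, s2, e, h1, h2⟩ := List.sublist_append_iff.1 hs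
    cases s1 with
    | cons z s1 =>
      simp at e
      exact absurd (h1.subset (by simp [e.1])) h.xu
    | nil =>
      simp at e; subst e
      have h3 := List.cons_sublist_cons.1 h2
      by_cases hb : b = a
      · subst hb
        have := h3.count_le b
        simp [List.count_eq_zero_of_not_mem h.xv] at this
      · have := h3.subset (show b ∈ [b, a] by simp)
        simp [hb] at this
        exact hx b this
  · have hne : a ≠ x := by rintro rfl; exact h.xv H
    have hnu : a ∉ u := fun q => h.uv a q H
    obtain ⟨s1, s2, e, h1, h2⟩ := List.sublist_append_iff.1 hs
    cases s1 with
    | cons z s1 =>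
      simp at e
      exact absurd (h1.subset (by simp [e.1])) hnu
    | nil =>
      simp at e; subst e
      have h3 : [a, b, a].Sublist (v ++ [x]) := by
        rcases List.sublist_cons_iff.1 h2 with h3 | ⟨r, h3, h4⟩
        · exact h3
        · simp at h3; exact absurd h3.1 hne
      obtain ⟨t1, t2, e, h4, h5⟩ := List.sublist_append_iff.1 h3
      rcases List.eq_nil_or_concat t2 with rfl | ⟨s, z, rfl⟩
      · simp at e; subst e; exact hv a b h4
      · exfalso
        rw [List.concat_eq_append] at e h5
        have e' := congrArg List.getLast? e
        simp at e'
        subst e'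
        have := h5.subset (show a ∈ s ++ [a] by simp)
        simp at this
        exact hne this

theorem St_gw : ∀ T : CTree, Good T → St (gw T)
  | leaf m => by intro _ a b h; simp [gw] at h
  | node _ l r => fun h => St_step (sep h) (St_gw l h.l) (St_gw r h.r) fun _ hb => gw_lt h.r hb

theorem gw_inj : ∀ T T' : CTree, Good T → Good T' → T.Mono → T'.Mono → minLeaf T = minLeaf T' →
    gw T = gw T' → T = T'
  | leaf m, leaf m', _, _, _, _, h, _ => by simpa [minLeaf] using h
  | leaf m, node _ l r, _, _, _, _, _, h => by simp [gw] at h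
  | node _ l r, leaf m, _, _, _, _, _, h => by simp [gw] at h
  | node c l r, node c' l' r', g, g', m, m', h, e => by
    have hx : minLeaf r = minLeaf r' := by
      have := congrArg List.getLast? e
      simpa [gw_last] using this
    simp only [gw, ← hx] at e
    have e1 : gw l ++ (minLeaf r :: gw r) = gw l' ++ (minLeaf r :: gw r') := by
      have := congrArg List.dropLast e
      rw [← List.cons_append, ← List.cons_append, ← List.append_assoc, ← List.append_assoc,
        List.dropLast_concat, List.dropLast_concat] at this
      exact this
    have n1 : minLeaf r ∉ gw l := (sep g).xu
    have n2 : minLeaf r ∉ gw r := (sep g).xv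
    obtain ⟨e2, -, e3⟩ := (List.append_cons_inj_of_notMem n1 n2).1 e1
    have hm : minLeaf l = minLeaf l' := by
      have := g.lt; have := g'.lt
      simp only [minLeaf] at h
      omega
    obtain ⟨rfl, m1, m2⟩ := m
    obtain ⟨rfl, m1', m2'⟩ := m'
    rw [gw_inj l l' g.l g'.l m1 m1' hm e2, gw_inj r r' g.r g'.r m2 m2' hx e3]

theorem gw_surj : ∀ (k : ℕ) (w : List ℕ), w.length ≤ k → ∀ m, (∀ a ∈ w, m < a) → St w →
    (∀ a ∈ w, w.count a = 2) → ∃ T : CTree, Good T ∧ T.Mono ∧ minLeaf T = m ∧ gw T = w := by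
  intro k
  induction k with
  | zero =>
    intro w hw m _ _ _
    have : w = [] := by simpa using hw
    subst this
    exact ⟨leaf m, ⟨trivial, by simp [leavesList]⟩, trivial, rfl, rfl⟩
  | succ k ih =>
    intro w hw m hm hst hc
    rcases List.eq_nil_or_concat' w with rfl | ⟨w', x, rfl⟩
    · exact ⟨leaf m, ⟨trivial, by simp [leavesList]⟩, trivial, rfl, rfl⟩
    have hx1 : w'.count x = 1 := by simpa using hc x (by simp)
    have hxm : x ∈ w' := List.count_pos_iff.1 (by omega)
    obtain ⟨u, v, rfl⟩ := List.append_of_mem hxm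
    simp at hx1
    have hxu : x ∉ u := fun q => by have := List.count_pos_iff.2 q; omega
    have hxv : x ∉ v := fun q => by have := List.count_pos_iff.2 q; omega
    have hvx : ∀ b ∈ v, x < b := by
      intro b hb
      apply hst
      simp only [List.append_assoc, List.cons_append]
      refine List.Sublist.trans ?_ (List.sublist_append_right u _)
      refine List.Sublist.cons_cons x ?_
      exact (List.singleton_sublist.2 hb).append (List.Sublist.refl [x])
    have huv : ∀ a ∈ u, a ∉ v := by
      intro a ha hav
      have h1 := hvx a hav
      have h2 : a < x := by
        apply hst
        simp only [List.append_assoc, List.cons_append]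
        refine (List.singleton_sublist.2 ha).append (List.Sublist.cons_cons x ?_)
        exact (List.singleton_sublist.2 hav).trans (List.sublist_append_left v _)
      omega
    have hcu : ∀ a ∈ u, u.count a = 2 := by
      intro a ha
      have h1 := hc a (by simp [ha])
      have h2 : x ≠ a := by rintro rfl; exact hxu ha
      simpa [List.count_cons, List.count_eq_zero_of_not_mem (huv a ha), h2] using h1
    have hcv : ∀ a ∈ v, v.count a = 2 := by
      intro a ha
      have h1 := hc a (by simp [ha])
      have h2 : x ≠ a := by rintro rfl; exact hxv ha
      have h3 : a ∉ u := fun q => huv a q ha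
      simpa [List.count_cons, List.count_eq_zero_of_not_mem h3, h2] using h1
    have hlen : u.length + v.length + 2 ≤ k + 1 := by simp at hw; omega
    obtain ⟨Tl, gl, ml, el, wl⟩ := ih u (by omega) m (fun a ha => hm a (by simp [ha]))
      (fun a b h => hst a b (h.trans (by simp))) hcu
    obtain ⟨Tr, gr, mr, er, wr⟩ := ih v (by omega) x hvx
      (fun a b h => hst a b (h.trans (by
        simp only [List.append_assoc, List.cons_append]
        exact ((List.sublist_append_left v [x]).trans (List.sublist_cons_self _ _)).trans
          (List.sublist_append_right _ _)))) hcv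
    have hmx : m < x := hm x (by simp)
    refine ⟨node 0 Tl Tr, ⟨⟨gl.1, gr.1, by omega⟩, ?_⟩, ⟨rfl, ml, mr⟩, ?_, ?_⟩
    · simp only [leavesList]
      rw [List.nodup_append]
      refine ⟨gl.2, gr.2, ?_⟩
      rintro a ha b hb rfl
      have h1 := mem_gw Tl gl a
      have h2 := mem_gw Tr gr a
      have h3 := minLeaf_le Tr a hb
      rw [wl, el] at h1
      rw [wr, er] at h2
      have h4 : a ∈ u := h1.2 ⟨ha, by omega⟩
      by_cases hax : a = x
      · subst hax; exact hxu h4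
      · exact huv a h4 (h2.2 ⟨hb, hax⟩)
    · simp only [minLeaf]; omega
    · simp [gw, wl, wr, er]

theorem NorSet_facts {n : ℕ} (hn : 1 ≤ n) {T : CTree} (h : T ∈ NorSet n) :
    Good T ∧ (∀ a, a ∈ leavesList T ↔ 1 ≤ a ∧ a ≤ n) ∧ minLeaf T = 1 ∧
      (∀ a, a ∈ gw T ↔ 2 ≤ a ∧ a ≤ n) := by
  obtain ⟨h1, h2, h3⟩ := h
  have hnd : T.leavesList.Nodup :=
    h1.nodup_iff.2 (List.nodup_range.map (add_left_injective 1))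
  have hmem : ∀ a, a ∈ leavesList T ↔ 1 ≤ a ∧ a ≤ n := by
    intro a
    rw [h1.mem_iff]
    simp only [List.mem_map, List.mem_range]
    constructor
    · rintro ⟨b, hb, rfl⟩; omega
    · intro h; exact ⟨a - 1, by omega, by omega⟩
  have hg : Good T := ⟨h2, hnd⟩
  have hmin : minLeaf T = 1 := by
    have h4 := minLeaf_le T 1 ((hmem 1).2 ⟨le_refl _, hn⟩)
    have h5 := (hmem _).1 (minLeaf_mem T)
    omega
  refine ⟨hg, hmem, hmin, fun a => ?_⟩
  rw [mem_gw T hg, hmem, hmin]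
  omega

theorem NorSet_of {n : ℕ} (hn : 1 ≤ n) {T : CTree} (g : Good T) (m : T.Mono) (h1 : minLeaf T = 1)
    (h : ∀ a, a ∈ gw T ↔ 2 ≤ a ∧ a ≤ n) : T ∈ NorSet n := by
  refine ⟨?_, g.1, m⟩
  unfold OnSet
  rw [List.perm_ext_iff_of_nodup g.2 (List.nodup_range.map (add_left_injective 1))]
  intro a
  have h2 := mem_gw T g a
  rw [h, h1] at h2
  have h3 := minLeaf_mem T
  rw [h1] at h3
  simp only [List.mem_map, List.mem_range]
  constructor
  · intro ha
    by_cases ha1 : a = 1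
    · exact ⟨0, by omega, by omega⟩
    · have := h2.2 ⟨ha, ha1⟩
      exact ⟨a - 1, by omega, by omega⟩
  · rintro ⟨b, hb, rfl⟩
    by_cases ha1 : b + 1 = 1
    · rw [ha1]; exact h3
    · exact (h2.1 (by omega)).1

theorem gamma_bijOn (n : ℕ) (hn : 1 ≤ n) : Set.BijOn gammaMap (NorSet n) (QSet (n - 1)) := by
  refine ⟨?_, ?_, ?_⟩
  · intro T hT
    obtain ⟨g, hl, hm, hw⟩ := NorSet_facts hn hT
    have hpos : ∀ a ∈ gw T, 1 ≤ a := fun a ha => by have := (hw a).1 ha; omega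
    rw [gammaMap_eq T g.1]
    change IsStirling _ _
    rw [isStirling_iff]
    refine ⟨fun a => ?_, ?_⟩
    · rw [← count_map_succ, map_pred_succ hpos]
      split_ifs with ha
      · rw [Finset.mem_Icc] at ha
        exact count_gw T g _ ((hw _).2 (by omega))
      · rw [Finset.mem_Icc] at ha
        exact List.count_eq_zero_of_not_mem fun q => ha (by have := (hw _).1 q; omega)
    · rw [← St_map_succ, map_pred_succ hpos]
      exact St_gw T g
  · intro T hT T' hT' e
    obtain ⟨g, hl, hm, hw⟩ := NorSet_facts hn hT
    obtain ⟨g', hl', hm', hw'⟩ := NorSet_facts hn hT'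
    have hpos : ∀ a ∈ gw T, 1 ≤ a := fun a ha => by have := (hw a).1 ha; omega
    have hpos' : ∀ a ∈ gw T', 1 ≤ a := fun a ha => by have := (hw' a).1 ha; omega
    rw [gammaMap_eq T g.1, gammaMap_eq T' g'.1] at e
    have e' := congrArg (List.map (· + 1)) e
    rw [map_pred_succ hpos, map_pred_succ hpos'] at e'
    exact gw_inj T T' g g' hT.2.2 hT'.2.2 (hm.trans hm'.symm) e'
  · intro w hw
    obtain ⟨hc, hst⟩ := (isStirling_iff _ _).1 (show IsStirling _ _ from hw)
    have hmem : ∀ a, a ∈ w ↔ 1 ≤ a ∧ a ≤ n - 1 := by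
      intro a
      rw [← List.count_pos_iff, hc, ← Finset.mem_Icc]
      split_ifs with h <;> simp [h]
    have hmem' : ∀ a, a ∈ w.map (· + 1) ↔ 2 ≤ a ∧ a ≤ n := by
      intro a
      rw [List.mem_map]
      constructor
      · rintro ⟨b, hb, rfl⟩
        have := (hmem b).1 hb; omega
      · intro h
        exact ⟨a - 1, (hmem _).2 (by omega), by omega⟩
    obtain ⟨T, g, m, h1, h2⟩ := gw_surj _ (w.map (· + 1)) le_rfl 1
      (fun a ha => by have := (hmem' a).1 ha; omega) ((St_map_succ w).2 hst) (by
        intro a ha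
        obtain ⟨b, hb, rfl⟩ := List.mem_map.1 ha
        rw [count_map_succ, hc, if_pos (Finset.mem_Icc.2 ((hmem b).1 hb))])
    refine ⟨T, NorSet_of hn g m h1 (by rw [h2]; exact hmem'), ?_⟩
    rw [gammaMap_eq T g.1, h2, List.map_map]
    simp [Function.comp_def]

open CTree in
/-- `γ : Nor_n → Q_{n-1}` is a well-defined bijection; non-Lyndon internal nodes
correspond to ascending adjacent pairs of `γ(Υ)` (via reduced valencies of
`R(L(x))` and `R(x)`), internal right children correspond to terminally nested
pairs (via reduced valencies of `R(x)` and `R(R(x))`), and consequently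
`λ^{AA}(γ(Υ)) = λ^{Lyn}(Υ)` and `λ^{TN}(γ(Υ)) = λ^{Comb}(Υ)`. -/
theorem gamma_bijection_and_types (n : ℕ) (hn : 1 ≤ n) :
    Set.BijOn gammaMap (NorSet n) (QSet (n - 1)) ∧
    (∀ T ∈ NorSet n, ∀ c cl : ℕ, ∀ ll lr r : CTree,
        node c (node cl ll lr) r ∈ subtreesC T →
        (minLeaf lr ≤ minLeaf r ↔
          AApair (gammaMap T) (minLeaf lr - 1) (minLeaf r - 1))) ∧
    (∀ T ∈ NorSet n, ∀ a b : ℕ, AApair (gammaMap T) a b →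
        ∃ (c cl : ℕ) (ll lr r : CTree), node c (node cl ll lr) r ∈ subtreesC T ∧
          minLeaf lr ≤ minLeaf r ∧ a = minLeaf lr - 1 ∧ b = minLeaf r - 1) ∧
    (∀ T ∈ NorSet n, ∀ c cr : ℕ, ∀ l rl rr : CTree,
        node c l (node cr rl rr) ∈ subtreesC T →
        TNpair (gammaMap T) (min (minLeaf rl) (minLeaf rr) - 1) (minLeaf rr - 1)) ∧
    (∀ T ∈ NorSet n, ∀ a b : ℕ, TNpair (gammaMap T) a b →
        ∃ (c cr : ℕ) (l rl rr : CTree), node c l (node cr rl rr) ∈ subtreesC T ∧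
          a = min (minLeaf rl) (minLeaf rr) - 1 ∧ b = minLeaf rr - 1) ∧
    (∀ T ∈ NorSet n,
        chainType (Finset.Icc 1 (n - 1)) (AApair (gammaMap T)) = lynType T) ∧
    (∀ T ∈ NorSet n,
        chainType (Finset.Icc 1 (n - 1)) (TNpair (gammaMap T)) = combType T) := by
  refine ⟨gamma_bijOn n hn, ?_, ?_, ?_, ?_, ?_, ?_⟩
  · intro T hT c cl ll lr r hmem
    obtain ⟨g, hl, hm, hw⟩ := NorSet_facts hn hT
    have hpos : ∀ a ∈ gw T, 1 ≤ a := fun a ha => by have := (hw a).1 ha; omega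
    have gs := subtree_good T g _ hmem
    have h1 := gs.lt
    have h2 := gs.l.lt
    constructor
    · intro hle
      rw [gammaMap_eq T g.1, AApair_pred hpos, Nat.sub_add_cancel (by omega),
        Nat.sub_add_cancel (by omega)]
      exact AA_of_node T g c cl ll lr r hmem hle
    · intro h
      have := h.1
      omega
  · intro T hT a b hab
    obtain ⟨g, hl, hm, hw⟩ := NorSet_facts hn hT
    have hpos : ∀ a ∈ gw T, 1 ≤ a := fun a ha => by have := (hw a).1 ha; omega
    rw [gammaMap_eq T g.1, AApair_pred hpos] at hab
    obtain ⟨c, cl, ll, lr, r, h1, h2, h3, h4⟩ := node_of_AA T g _ _ hab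
    exact ⟨c, cl, ll, lr, r, h1, h2, by omega, by omega⟩
  · intro T hT c cr l rl rr hmem
    obtain ⟨g, hl, hm, hw⟩ := NorSet_facts hn hT
    have hpos : ∀ a ∈ gw T, 1 ≤ a := fun a ha => by have := (hw a).1 ha; omega
    have gs := subtree_good T g _ hmem
    have h1 : minLeaf l < min (minLeaf rl) (minLeaf rr) := gs.lt
    rw [gammaMap_eq T g.1, TNpair_pred hpos, Nat.sub_add_cancel (by omega),
      Nat.sub_add_cancel (by omega)]
    exact TN_of_node T g c cr l rl rr hmem
  · intro T hT a b hab
    obtain ⟨g, hl, hm, hw⟩ := NorSet_facts hn hT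
    have hpos : ∀ a ∈ gw T, 1 ≤ a := fun a ha => by have := (hw a).1 ha; omega
    rw [gammaMap_eq T g.1, TNpair_pred hpos] at hab
    obtain ⟨c, cr, l, rl, rr, h1, h2, h3⟩ := node_of_TN T g _ _ hab
    exact ⟨c, cr, l, rl, rr, h1, by omega, by omega⟩
  · intro T hT
    obtain ⟨g, hl, hm, hw⟩ := NorSet_facts hn hT
    have hpos : ∀ a ∈ gw T, 1 ≤ a := fun a ha => by have := (hw a).1 ha; omega
    obtain ⟨q, P, h1, h2, h3, -⟩ := lyn_part T g
    rw [gammaMap_eq T g.1, h1.pred (fun a ha => hpos a (by simpa using ha))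
      (fun a => by rw [List.mem_toFinset, hw, Finset.mem_Icc]; omega) (AApair_pred hpos),
      h1.chainType_eq, type_aux h2 h3]
    rfl
  · intro T hT
    obtain ⟨g, hl, hm, hw⟩ := NorSet_facts hn hT
    have hpos : ∀ a ∈ gw T, 1 ≤ a := fun a ha => by have := (hw a).1 ha; omega
    obtain ⟨q, P, h1, h2, h3, -⟩ := comb_part T g
    rw [gammaMap_eq T g.1, h1.pred (fun a ha => hpos a (by simpa using ha))
      (fun a => by rw [List.mem_toFinset, hw, Finset.mem_Icc]; omega) (TNpair_pred hpos),
      h1.chainType_eq, type_aux h2 h3]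
    rfl
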